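/- Let (T,d) be a separable ℝ-tree containing at least two points. Then the set { x ∈ T : T∖{x} has exactly two connected components } (the points of degree 2) is dense in T. -/

import Mathlib

open Set MeasureTheory Filter Metric

/-- The metric segment `[[x,y]]` between `x` and `y`. -/
def geoSeg {T : Type*} [MetricSpace T] (x y : T) : Set T :=
  {z | dist x z + dist z y = dist x y}

/-- `(T,d)` is an `ℝ`-tree: it is geodesic (any two points are joined by a geodesic
segment, which is `geoSeg x y`) and loopless (this segment is the unique arc joining
`x` and `y`). -/
structure IsRTree (T : Type*) [MetricSpace T] : Prop where
  geodesic : ∀ x y : T, ∃ γ : ℝ → T, γ 0 = x ∧ γ (dist x y) = y ∧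
    (∀ s ∈ Icc (0:ℝ) (dist x y), ∀ t ∈ Icc (0:ℝ) (dist x y),
      dist (γ s) (γ t) = |s - t|) ∧
    γ '' Icc (0:ℝ) (dist x y) = geoSeg x y
  loopless : ∀ x y : T, ∀ f : ℝ → T, ContinuousOn f (Icc (0:ℝ) 1) →
    InjOn f (Icc (0:ℝ) 1) → f 0 = x → f 1 = y → f '' Icc (0:ℝ) 1 = geoSeg x y

/-- The set of connected components of `T \ {x}`. -/
def comps {T : Type*} [MetricSpace T] (x : T) : Set (Set T) :=
  {C | ∃ y, y ≠ x ∧ C = connectedComponentIn ({x}ᶜ) y}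


theorem geoSeg_comm {T : Type*} [MetricSpace T] (x y : T) : geoSeg x y = geoSeg y x := by
  ext z
  simp only [geoSeg, mem_ofPred_eq]
  rw [dist_comm x z, dist_comm z y, dist_comm x y, add_comm]

theorem left_mem_geoSeg {T : Type*} [MetricSpace T] (x y : T) : x ∈ geoSeg x y := by
  simp [geoSeg]

theorem right_mem_geoSeg {T : Type*} [MetricSpace T] (x y : T) : y ∈ geoSeg x y := by
  simp [geoSeg]

theorem isClosed_geoSeg {T : Type*} [MetricSpace T] (x y : T) : IsClosed (geoSeg x y) :=
  isClosed_eq (by fun_prop) (by fun_prop)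

theorem geoSeg_subset_of_mem_left {T : Type*} [MetricSpace T] {x y m : T}
    (hm : m ∈ geoSeg x y) : geoSeg m y ⊆ geoSeg x y := by
  intro u hu
  simp only [geoSeg, mem_ofPred_eq] at *
  linarith [dist_triangle x m u, dist_triangle x u y]

theorem notMem_geoSeg_of_dist_lt {T : Type*} [MetricSpace T] {p y z : T}
    (h : dist y z < dist y p) : p ∉ geoSeg y z := by
  intro hp
  simp only [geoSeg, mem_ofPred_eq] at hp
  linarith [dist_nonneg (x := p) (y := z)]

namespace IsRTree

variable {T : Type*} [MetricSpace T]

theorem exists_geodesic (hT : IsRTree T) (x y : T) :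
    ∃ γ : ℝ → T, γ 0 = x ∧ γ (dist x y) = y ∧ Continuous γ ∧
      (∀ s ∈ Icc (0 : ℝ) (dist x y), ∀ t ∈ Icc (0 : ℝ) (dist x y),
        dist (γ s) (γ t) = |s - t|) ∧
      γ '' Icc (0 : ℝ) (dist x y) = geoSeg x y := by
  obtain ⟨γ, h0, h1, hiso, himg⟩ := hT.geodesic x y
  have hL : (0 : ℝ) ≤ dist x y := dist_nonneg
  have heq : ∀ t ∈ Icc (0 : ℝ) (dist x y), γ (projIcc 0 _ hL t) = γ t := fun t ht => by
    rw [projIcc_of_mem hL ht]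
  have hcont : Continuous fun u : Icc (0 : ℝ) (dist x y) => γ u :=
    Isometry.continuous <| Isometry.of_dist_eq fun s t => by
      rw [hiso s s.2 t t.2, Subtype.dist_eq, Real.dist_eq]
  refine ⟨fun t => γ (projIcc 0 _ hL t), ?_, ?_, hcont.comp continuous_projIcc, ?_, ?_⟩
  · simpa [heq 0 ⟨le_rfl, hL⟩] using h0
  · simpa [heq _ ⟨hL, le_rfl⟩] using h1
  · intro s hs t ht
    simp only [heq s hs, heq t ht, hiso s hs t ht]
  · rw [← himg]
    exact image_congr heq

theorem isPreconnected_geoSeg (hT : IsRTree T) (x y : T) : IsPreconnected (geoSeg x y) := by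
  obtain ⟨γ, -, -, hcont, -, himg⟩ := hT.exists_geodesic x y
  exact himg ▸ isPreconnected_Icc.image γ hcont.continuousOn

/-- Concatenating two geodesics which only meet at their common endpoint `m` gives an arc, hence
the segment between the other two endpoints. -/
theorem geoSeg_subset_union_of_inter (hT : IsRTree T) {x m z : T}
    (h : ∀ u ∈ geoSeg x m, u ∈ geoSeg m z → u = m) :
    geoSeg x z ⊆ geoSeg x m ∪ geoSeg m z := by
  obtain ⟨γ, γ0, γ1, γc, γiso, γimg⟩ := hT.exists_geodesic x m
  obtain ⟨δ, δ0, δ1, δc, δiso, δimg⟩ := hT.exists_geodesic m z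
  have γmem : ∀ t ∈ Icc 0 (dist x m), γ t ∈ geoSeg x m :=
    fun t ht => γimg ▸ mem_image_of_mem γ ht
  have δmem : ∀ t ∈ Icc 0 (dist m z), δ t ∈ geoSeg m z :=
    fun t ht => δimg ▸ mem_image_of_mem δ ht
  have ha : 0 ≤ dist x m := dist_nonneg
  have hb : 0 ≤ dist m z := dist_nonneg
  set a := dist x m
  set b := dist m z
  rcases (add_nonneg ha hb).eq_or_lt with hab | hab
  · have hxm : x = m := dist_le_zero.1 (by change a ≤ 0; linarith)
    subst hxm
    exact subset_union_right
  let f : ℝ → T := fun s => if (a + b) * s ≤ a then γ ((a + b) * s) else δ ((a + b) * s - a)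
  have hfc : Continuous f := by
    refine Continuous.if_le (γc.comp (by fun_prop)) (δc.comp (by fun_prop)) (by fun_prop)
      (by fun_prop) fun s hs => ?_
    simp [hs, γ1, δ0]
  have hbd : ∀ s ∈ Icc (0 : ℝ) 1, 0 ≤ (a + b) * s ∧ (a + b) * s ≤ a + b := fun s hs =>
    ⟨mul_nonneg hab.le hs.1, mul_le_of_le_one_right hab.le hs.2⟩
  have hcross : ∀ s ∈ Icc (0 : ℝ) a, ∀ t ∈ Icc (0 : ℝ) b, γ s = δ t → t = 0 := by
    intro s hs t ht hst
    have hm : δ t = m := h _ (hst ▸ γmem s hs) (δmem t ht)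
    have := δiso t ht 0 ⟨le_rfl, hb⟩
    rw [hm, δ0, dist_self, sub_zero] at this
    exact abs_eq_zero.1 this.symm
  have hfi : InjOn f (Icc 0 1) := by
    intro s hs t ht hst
    obtain ⟨hs0, hs1⟩ := hbd s hs
    obtain ⟨ht0, ht1⟩ := hbd t ht
    apply mul_left_cancel₀ hab.ne'
    simp only [f] at hst
    split_ifs at hst with h1 h2 h2
    · have := γiso _ ⟨hs0, h1⟩ _ ⟨ht0, h2⟩
      rw [hst, dist_self] at this
      exact sub_eq_zero.1 (abs_eq_zero.1 this.symm)
    · have := hcross _ ⟨hs0, h1⟩ _ ⟨by linarith, by linarith⟩ hst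
      linarith
    · have := hcross _ ⟨ht0, h2⟩ _ ⟨by linarith, by linarith⟩ hst.symm
      linarith
    · have := δiso ((a + b) * s - a) ⟨by linarith, by linarith⟩ ((a + b) * t - a)
        ⟨by linarith, by linarith⟩
      rw [hst, dist_self] at this
      linarith [abs_eq_zero.1 this.symm]
  have hf0 : f 0 = x := by simp [f, ha, γ0]
  have hf1 : f 1 = z := by
    simp only [f, mul_one]
    split_ifs with h1
    · have hb0 : b = 0 := by linarith
      rw [hb0, add_zero, γ1]
      exact dist_le_zero.1 hb0.le
    · rw [add_sub_cancel_left, δ1]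
  rw [← hT.loopless x z f hfc.continuousOn hfi hf0 hf1]
  rintro _ ⟨s, hs, rfl⟩
  obtain ⟨hs0, hs1⟩ := hbd s hs
  simp only [f]
  split_ifs with h1
  · exact Or.inl (γmem _ ⟨hs0, h1⟩)
  · exact Or.inr (δmem _ ⟨by linarith, by linarith⟩)

theorem geoSeg_subset_union (hT : IsRTree T) (x y z : T) :
    geoSeg x z ⊆ geoSeg x y ∪ geoSeg y z := by
  obtain ⟨γ, γ0, γ1, γc, γiso, γimg⟩ := hT.exists_geodesic x y
  have γmem : ∀ t ∈ Icc 0 (dist x y), γ t ∈ geoSeg x y :=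
    fun t ht => γimg ▸ mem_image_of_mem γ ht
  have hL : 0 ≤ dist x y := dist_nonneg
  have hS : IsCompact (Icc 0 (dist x y) ∩ γ ⁻¹' geoSeg y z) :=
    isCompact_Icc.inter_right ((isClosed_geoSeg y z).preimage γc)
  obtain ⟨a, ⟨haI, haS⟩, hmin⟩ := hS.exists_isLeast
    ⟨dist x y, ⟨hL, le_rfl⟩, by rw [mem_preimage, γ1]; exact left_mem_geoSeg y z⟩
  have hxa : dist x (γ a) = a := by
    have := γiso 0 ⟨le_rfl, hL⟩ a haI
    rwa [γ0, zero_sub, abs_neg, abs_of_nonneg haI.1] at this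
  have hsub : geoSeg x (γ a) ⊆ geoSeg x y := by
    rw [geoSeg_comm x, geoSeg_comm x]
    exact geoSeg_subset_of_mem_left (geoSeg_comm x y ▸ γmem a haI)
  have hsub' : geoSeg (γ a) z ⊆ geoSeg y z := geoSeg_subset_of_mem_left haS
  refine (hT.geoSeg_subset_union_of_inter ?_).trans (union_subset_union hsub hsub')
  intro u hu hu'
  obtain ⟨t, ht, rfl⟩ := γimg.symm ▸ hsub hu
  have hxt : dist x (γ t) = t := by
    have := γiso 0 ⟨le_rfl, hL⟩ t ht
    rwa [γ0, zero_sub, abs_neg, abs_of_nonneg ht.1] at this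
  have hat : a ≤ t := hmin ⟨ht, hsub' hu'⟩
  simp only [geoSeg, mem_ofPred_eq] at hu
  exact dist_le_zero.1 (by linarith)

theorem notMem_geoSeg_trans (hT : IsRTree T) {p x y z : T} (hxy : p ∉ geoSeg x y)
    (hyz : p ∉ geoSeg y z) : p ∉ geoSeg x z :=
  fun h => (hT.geoSeg_subset_union x y z h).elim hxy hyz

theorem connectedComponentIn_compl_singleton (hT : IsRTree T) {p y : T} (hy : y ≠ p) :
    connectedComponentIn {p}ᶜ y = {z | p ∉ geoSeg y z} := by
  have hne : ∀ {z}, p ∉ geoSeg y z → z ≠ p := fun hz h => hz (h ▸ right_mem_geoSeg y _)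
  apply Subset.antisymm
  · have hU : IsOpen {z | p ∉ geoSeg y z} := by
      refine Metric.isOpen_iff.2 fun z hz => ⟨dist z p, dist_pos.2 (hne hz), fun u hu => ?_⟩
      exact hT.notMem_geoSeg_trans hz (notMem_geoSeg_of_dist_lt (mem_ball'.1 hu))
    have hV : IsOpen {z | z ≠ p ∧ p ∈ geoSeg y z} := by
      refine Metric.isOpen_iff.2 fun z hz => ⟨dist z p, dist_pos.2 hz.1, fun u hu => ?_⟩
      have hzu := notMem_geoSeg_of_dist_lt (mem_ball'.1 hu)
      exact ⟨fun h => hzu (h ▸ right_mem_geoSeg z u),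
        by_contra fun h => hT.notMem_geoSeg_trans h (geoSeg_comm z u ▸ hzu) hz.2⟩
    intro z hz
    by_contra hzU
    have hsub := connectedComponentIn_subset ({p}ᶜ : Set T) y
    have hyC := mem_connectedComponentIn (F := ({p}ᶜ : Set T)) hy
    obtain ⟨u, -, hu, hu'⟩ := isPreconnected_connectedComponentIn
      (F := ({p}ᶜ : Set T)) (x := y) _ _ hU hV
      (fun u hu => (em (p ∈ geoSeg y u)).symm.imp id fun h => ⟨hsub hu, h⟩)
      ⟨y, hyC, notMem_geoSeg_of_dist_lt (by simpa using hy)⟩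
      ⟨z, hz, hsub hz, not_not.1 hzU⟩
    exact hu hu'.2
  · intro z hz
    exact (hT.isPreconnected_geoSeg y z).subset_connectedComponentIn (left_mem_geoSeg y z)
      (subset_compl_singleton_iff.2 hz) (right_mem_geoSeg y z)

theorem connectedComponentIn_compl_singleton_eq (hT : IsRTree T) {p y z : T}
    (hp : p ∉ geoSeg y z) :
    connectedComponentIn {p}ᶜ y = connectedComponentIn {p}ᶜ z := by
  have hy : y ≠ p := fun h => hp (h ▸ left_mem_geoSeg y z)
  apply connectedComponentIn_eq
  rw [hT.connectedComponentIn_compl_singleton hy]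
  exact hp

theorem ncard_comps_eq_two (hT : IsRTree T) {p x w : T} (hp : p ∈ geoSeg x w) (hx : x ≠ p)
    (hw : w ≠ p) (h : ∀ y, y ≠ p → p ∈ geoSeg x y → p ∉ geoSeg w y) :
    (comps p).ncard = 2 := by
  have heq : comps p = {connectedComponentIn {p}ᶜ x, connectedComponentIn {p}ᶜ w} := by
    ext C
    constructor
    · rintro ⟨y, hy, rfl⟩
      by_cases hxy : p ∈ geoSeg x y
      · exact Or.inr (hT.connectedComponentIn_compl_singleton_eq (h y hy hxy)).symm
      · exact Or.inl (hT.connectedComponentIn_compl_singleton_eq hxy).symm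
    · rintro (rfl | rfl)
      exacts [⟨x, hx, rfl⟩, ⟨w, hw, rfl⟩]
  rw [heq, ncard_pair]
  intro hC
  have hwC := mem_connectedComponentIn (F := ({p}ᶜ : Set T)) hw
  rw [← hC, hT.connectedComponentIn_compl_singleton hx] at hwC
  exact hwC hp

end IsRTree

/-- In a separable `ℝ`-tree with at least two points, the set of points of degree 2
(points `x` such that `T \ {x}` has exactly two connected components) is dense. -/
theorem degree_two_points_dense (T : Type*) [MetricSpace T]
    [TopologicalSpace.SeparableSpace T] (hT : IsRTree T)
    (x₀ y₀ : T) (hxy : x₀ ≠ y₀) :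
    Dense {x : T | (comps x).ncard = 2} := by
  have : Nonempty T := ⟨x₀⟩
  rw [Metric.dense_iff]
  intro x ε hε
  obtain ⟨w, hw⟩ : ∃ w, w ≠ x := by
    by_cases h : x₀ = x
    · exact ⟨y₀, fun h' => hxy (h.trans h'.symm)⟩
    · exact ⟨x₀, h⟩
  have hL : 0 < dist x w := dist_pos.2 hw.symm
  obtain ⟨γ, h0, -, -, hiso, himg⟩ := hT.exists_geodesic x w
  let b : ℕ → ℝ := fun n =>
    (dist x w + dist x (TopologicalSpace.denseSeq T n)
      - dist w (TopologicalSpace.denseSeq T n)) / 2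
  have hunc : ¬ (Ioo 0 (min ε (dist x w))).Countable := by
    rw [← Cardinal.le_aleph0_iff_set_countable, Cardinal.mk_Ioo_real (lt_min hε hL), not_le]
    exact Cardinal.aleph0_lt_continuum
  obtain ⟨t, ⟨ht0, ht⟩, htb⟩ : ∃ t ∈ Ioo 0 (min ε (dist x w)), t ∉ range b := by
    by_contra! h
    exact hunc ((countable_range b).mono h)
  have htε := ht.trans_le (min_le_left _ _)
  have htL := ht.trans_le (min_le_right _ _)
  have htI : t ∈ Icc 0 (dist x w) := ⟨ht0.le, htL.le⟩
  have hxp : dist x (γ t) = t := by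
    have := hiso 0 ⟨le_rfl, hL.le⟩ t htI
    rwa [h0, zero_sub, abs_neg, abs_of_pos ht0] at this
  have hpw : γ t ∈ geoSeg x w := himg ▸ mem_image_of_mem γ htI
  generalize γ t = p at hxp hpw
  have hpw' : dist x p + dist p w = dist x w := hpw
  have hxne : x ≠ p := dist_pos.1 (hxp ▸ ht0)
  have hwne : w ≠ p := by
    rintro rfl
    exact htL.ne' hxp
  refine ⟨p, by rw [mem_ball, dist_comm, hxp]; exact htε, ?_⟩
  refine hT.ncard_comps_eq_two hpw hxne hwne fun y hy => ?_
  by_contra! hbad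
  obtain ⟨n, hn⟩ := (TopologicalSpace.denseRange_denseSeq T).exists_dist_lt y
    (dist_pos.2 hy)
  have hyn := notMem_geoSeg_of_dist_lt hn
  have hyn' : p ∉ geoSeg _ y := fun h => hyn (geoSeg_comm _ y ▸ h)
  have hxn : p ∈ geoSeg x _ := by_contra fun h => hT.notMem_geoSeg_trans h hyn' hbad.1
  have hwn : p ∈ geoSeg w _ := by_contra fun h => hT.notMem_geoSeg_trans h hyn' hbad.2
  refine htb ⟨n, ?_⟩
  simp only [geoSeg, mem_ofPred_eq] at hxn hwn
  rw [dist_comm w p] at hwn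
  simp only [b]
  linarith
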